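/- Define, for natural numbers n and q, A_{n,q} = { x : Fin n → ℕ | x(i) ≤ q - 1 for all i, and Σ_i x(i) ≤ 1.32·n } and B_n = { x : Fin n → ℕ | the number of indices i with x(i) = 0 is at least 0.5657·n }. Then there exist a real constant c > 1 and a natural number N such that for all n ≥ N and all integers q with q ≥ n + 1, the cardinality of A_{n,q} ∩ B_n is less than c^{-n} times the cardinality of A_{n,q}. -/

import Mathlib

lemma aux_block : Nat.card {y : Fin 100 → ℕ // ∑ i, y i = 132} = Nat.choose 231 132 := by
  rw [← Nat.card_congr (Sym.equivNatSumOfFintype (Fin 100) 132), Nat.card_eq_fintype_card,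
    Sym.card_sym_eq_choose]
  simp

lemma aux_finite (n q : ℕ) (p : (Fin n → ℕ) → Prop) :
    Finite {x : Fin n → ℕ // (∀ i, x i ≤ q) ∧ p x} := by
  have : Set.Finite {x : Fin n → ℕ | (∀ i, x i ≤ q) ∧ p x} := by
    apply (Set.finite_Iic (fun _ : Fin n => q)).subset
    intro x hx
    exact hx.1
  exact this

lemma aux_low (a : ℕ) : ∀ n, 100 * a ≤ n → (Nat.choose 231 132) ^ a ≤
    Nat.card {x : Fin n → ℕ // (∀ i, x i ≤ 132) ∧ ∑ i, x i ≤ 132 * a} := by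
  induction a with
  | zero =>
    intro n _
    have := aux_finite n 132 (fun x => ∑ i, x i ≤ 132 * 0)
    have : Nonempty {x : Fin n → ℕ // (∀ i, x i ≤ 132) ∧ ∑ i, x i ≤ 132 * 0} :=
      ⟨⟨fun _ => 0, by simp⟩⟩
    rw [pow_zero]
    exact Nat.card_pos
  | succ a ih =>
    intro n hn
    obtain ⟨m, rfl⟩ : ∃ m, n = m + 100 := ⟨n - 100, by omega⟩
    have h1 := ih m (by omega)
    have := aux_finite (m + 100) 132 (fun x => ∑ i, x i ≤ 132 * (a + 1))
    rw [pow_succ]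
    refine (Nat.mul_le_mul_right _ h1).trans ?_
    rw [← aux_block, ← Nat.card_prod]
    refine Nat.card_le_card_of_injective (fun p => ⟨Fin.append p.1.1 p.2.1, ?_, ?_⟩) ?_
    · intro i
      refine Fin.addCases (fun i => ?_) (fun i => ?_) i
      · rw [Fin.append_left]; exact p.1.2.1 i
      · rw [Fin.append_right]
        exact (Finset.single_le_sum (f := p.2.1) (fun _ _ => Nat.zero_le _)
          (Finset.mem_univ i)).trans p.2.2.le
    · rw [Fin.sum_univ_add]
      simp only [Fin.append_left, Fin.append_right]
      have := p.1.2.2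
      have := p.2.2
      omega
    · rintro ⟨⟨u, hu⟩, ⟨v, hv⟩⟩ ⟨⟨u', hu'⟩, ⟨v', hv'⟩⟩ h
      have h' : Fin.append u v = Fin.append u' v' := congrArg Subtype.val h
      have e1 : u = u' := by
        funext i
        have := congrFun h' (Fin.castAdd 100 i)
        simpa using this
      have e2 : v = v' := by
        funext i
        have := congrFun h' (Fin.natAdd m i)
        simpa using this
      subst e1 e2
      rfl

/-- the weight -/
noncomputable def auxF (j : ℕ) : ℝ := (2 / 3) ^ j * (if j = 0 then 8 / 3 else 1)

lemma auxF_nonneg (j : ℕ) : 0 ≤ auxF j := by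
  unfold auxF; split_ifs <;> positivity

lemma auxF_sum (q : ℕ) : ∑ j ∈ Finset.range q, auxF j ≤ 14 / 3 := by
  have h : ∀ q : ℕ, ∑ j ∈ Finset.range (q + 1), auxF j = 14 / 3 - 2 * (2 / 3) ^ q := by
    intro q
    induction q with
    | zero => simp [auxF]; norm_num
    | succ q ih =>
      rw [Finset.sum_range_succ, ih]
      simp only [auxF, Nat.succ_ne_zero, if_false, pow_succ]
      ring
  cases q with
  | zero => simp; norm_num
  | succ q =>
    rw [h]
    have : (0 : ℝ) ≤ (2 / 3) ^ q := by positivity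
    linarith

lemma auxF_prod (n : ℕ) (x : Fin n → ℕ) : ∏ i, auxF (x i) =
    (2 / 3) ^ (∑ i, x i) * (8 / 3) ^ (Finset.univ.filter fun i => x i = 0).card := by
  unfold auxF
  rw [Finset.prod_mul_distrib, Finset.prod_pow_eq_pow_sum, ← Finset.prod_filter,
    Finset.prod_const]

lemma aux_up (n q a : ℕ) (h1 : 100 * a ≤ n) (h2 : n ≤ 100 * (a + 1)) :
    (Nat.card {x : Fin n → ℕ //
          ((∀ i, x i ≤ q - 1) ∧ 25 * (∑ i, x i) ≤ 33 * n) ∧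
            5657 * n ≤ 10000 * (Finset.univ.filter fun i => x i = 0).card} : ℝ) *
      ((2 / 3) ^ (132 * (a + 1)) * (8 / 3) ^ (56 * a)) ≤ (14 / 3) ^ (100 * (a + 1)) := by
  classical
  set S : Finset (Fin n → ℕ) := (Fintype.piFinset fun _ : Fin n => Finset.range (q - 1 + 1)).filter
    (fun x => 25 * (∑ i, x i) ≤ 33 * n ∧
      5657 * n ≤ 10000 * (Finset.univ.filter fun i => x i = 0).card) with hS
  have hc : Nat.card {x : Fin n → ℕ //
          ((∀ i, x i ≤ q - 1) ∧ 25 * (∑ i, x i) ≤ 33 * n) ∧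
            5657 * n ≤ 10000 * (Finset.univ.filter fun i => x i = 0).card} = S.card := by
    apply Nat.subtype_card
    intro x
    simp only [hS, Finset.mem_filter, Fintype.mem_piFinset, Finset.mem_range, Nat.lt_succ_iff,
      and_assoc]
  rw [hc, ← nsmul_eq_mul]
  calc _ ≤ ∑ x ∈ S, ∏ i, auxF (x i) := by
        apply Finset.card_nsmul_le_sum
        intro x hx
        rw [hS, Finset.mem_filter] at hx
        obtain ⟨-, hx1, hx2⟩ := hx
        rw [auxF_prod]
        apply mul_le_mul
        · exact pow_le_pow_of_le_one (by norm_num) (by norm_num) (by omega)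
        · exact pow_le_pow_right₀ (by norm_num) (by omega)
        · positivity
        · positivity
    _ ≤ ∑ x ∈ Fintype.piFinset fun _ : Fin n => Finset.range (q - 1 + 1), ∏ i, auxF (x i) := by
        apply Finset.sum_le_sum_of_subset_of_nonneg (Finset.filter_subset _ _)
        intro x _ _
        exact Finset.prod_nonneg fun i _ => auxF_nonneg _
    _ = ∏ _i : Fin n, ∑ j ∈ Finset.range (q - 1 + 1), auxF j := by
        rw [Finset.prod_univ_sum]
    _ ≤ (14 / 3) ^ n := by
        rw [Finset.prod_const, Finset.card_univ, Fintype.card_fin]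
        exact pow_le_pow_left₀ (Finset.sum_nonneg fun j _ => auxF_nonneg _) (auxF_sum _) _
    _ ≤ _ := pow_le_pow_right₀ (by norm_num) h2

lemma aux_num : 8 * (14 / 3 : ℝ) ^ 100 ≤
    (Nat.choose 231 132 : ℝ) * ((2 / 3) ^ 132 * (8 / 3) ^ 56) := by
  have : Nat.choose 231 132 = 17173254009932400257666968574461639953868604235929762439436018858425 := by
    rw [Nat.choose_eq_descFactorial_div_factorial]
    norm_num [Nat.descFactorial, Nat.factorial]
  rw [this]
  norm_num

/-- Among digit tuples `x : Fin n → ℕ` with entries at most `q - 1` and sum at most `1.32 n`,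
the fraction having at least `0.5657 n` zero entries is exponentially small: there is a
constant `c > 1` such that `|A_{n,q} ∩ B_n| < c^{-n} * |A_{n,q}|` for all large `n`
and all `q ≥ n + 1`. -/
theorem sparse_digit_tuples_exponentially_rare :
    ∃ c : ℝ, 1 < c ∧ ∃ N : ℕ, ∀ n ≥ N, ∀ q : ℕ, n + 1 ≤ q →
      (Nat.card {x : Fin n → ℕ //
          ((∀ i, x i ≤ q - 1) ∧ 25 * (∑ i, x i) ≤ 33 * n) ∧
            5657 * n ≤ 10000 * (Finset.univ.filter fun i => x i = 0).card} : ℝ) <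
        c ^ (-(n : ℤ)) *
          (Nat.card {x : Fin n → ℕ //
            (∀ i, x i ≤ q - 1) ∧ 25 * (∑ i, x i) ≤ 33 * n} : ℝ) := by
  obtain ⟨k, hk⟩ := pow_unbounded_of_one_lt
    (2 * (14 / 3 : ℝ) ^ 100 / (2 / 3) ^ 132) (by norm_num : (1 : ℝ) < 4)
  refine ⟨201 / 200, by norm_num, 100 * k + 200, ?_⟩
  intro n hn q hq
  obtain ⟨a, h1, h2⟩ : ∃ a, 100 * a ≤ n ∧ n ≤ 100 * (a + 1) := ⟨n / 100, by omega, by omega⟩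
  have hka : k ≤ a := by omega
  have hup := aux_up n q a h1 h2
  have hlow : (Nat.choose 231 132) ^ a ≤ Nat.card {x : Fin n → ℕ //
            (∀ i, x i ≤ q - 1) ∧ 25 * (∑ i, x i) ≤ 33 * n} := by
    refine (aux_low a n h1).trans ?_
    have := aux_finite n (q - 1) (fun x => 25 * (∑ i, x i) ≤ 33 * n)
    refine Nat.card_le_card_of_injective (fun x => ⟨x.1, fun i => ?_, ?_⟩) ?_
    · have := x.2.1 i
      omega
    · have := x.2.2
      omega
    · intro x y h
      exact Subtype.ext (Subtype.mk.inj h)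
  have hlow' : ((Nat.choose 231 132 : ℕ) : ℝ) ^ a ≤ (Nat.card {x : Fin n → ℕ //
            (∀ i, x i ≤ q - 1) ∧ 25 * (∑ i, x i) ≤ 33 * n} : ℝ) := by exact_mod_cast hlow
  generalize (Nat.card {x : Fin n → ℕ //
            (∀ i, x i ≤ q - 1) ∧ 25 * (∑ i, x i) ≤ 33 * n} : ℝ) = Y at *
  generalize (Nat.card {x : Fin n → ℕ //
          ((∀ i, x i ≤ q - 1) ∧ 25 * (∑ i, x i) ≤ 33 * n) ∧
            5657 * n ≤ 10000 * (Finset.univ.filter fun i => x i = 0).card} : ℝ) = X at *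
  have hnum := aux_num
  generalize ((Nat.choose 231 132 : ℕ) : ℝ) = M at *
  have hc : (201 / 200 : ℝ) ^ n ≤ 2 ^ (a + 1) := by
    calc (201 / 200 : ℝ) ^ n ≤ (201 / 200) ^ (100 * (a + 1)) :=
          pow_le_pow_right₀ (by norm_num) h2
      _ = ((201 / 200) ^ 100) ^ (a + 1) := pow_mul _ _ _
      _ ≤ 2 ^ (a + 1) := pow_le_pow_left₀ (by norm_num) (by norm_num) _
  have hk' : 2 * (14 / 3 : ℝ) ^ 100 < 4 ^ a * (2 / 3) ^ 132 := by
    rw [← div_lt_iff₀ (by positivity)]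
    exact hk.trans_le (pow_le_pow_right₀ (by norm_num) hka)
  rw [mul_add, mul_add, pow_add, pow_add, mul_one, mul_one, pow_mul, pow_mul _ 56, pow_mul _ 100] at hup
  set G : ℝ := (14 / 3) ^ 100 with hG
  set P : ℝ := (2 / 3) ^ 132 with hP
  set Q : ℝ := (8 / 3) ^ 56 with hQ
  have G0 : 0 < G := by positivity
  have P0 : 0 < P := by positivity
  have Q0 : 0 < Q := by positivity
  clear_value G P Q
  have hpow : 8 ^ a * G ^ a ≤ M ^ a * (P ^ a * Q ^ a) := by
    rw [← mul_pow, ← mul_pow, ← mul_pow]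
    exact pow_le_pow_left₀ (by positivity) hnum a
  have h8 : (8 : ℝ) ^ a = 2 ^ a * 4 ^ a := by rw [← mul_pow]; norm_num
  rw [zpow_neg, zpow_natCast, lt_inv_mul_iff₀ (by positivity)]
  have PQ : 0 < P ^ a * Q ^ a := by positivity
  have key : (201 / 200 : ℝ) ^ n * X * (P ^ a * Q ^ a * P) < M ^ a * (P ^ a * Q ^ a * P) := by
    calc (201 / 200 : ℝ) ^ n * X * (P ^ a * Q ^ a * P)
        = (201 / 200 : ℝ) ^ n * (X * (P ^ a * P * Q ^ a)) := by ring
      _ ≤ (201 / 200 : ℝ) ^ n * (G ^ a * G) := by gcongr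
      _ ≤ 2 ^ (a + 1) * (G ^ a * G) := by gcongr
      _ = (2 ^ a * G ^ a) * (2 * G) := by ring
      _ < (2 ^ a * G ^ a) * (4 ^ a * P) := by gcongr
      _ = (8 ^ a * G ^ a) * P := by rw [h8]; ring
      _ ≤ (M ^ a * (P ^ a * Q ^ a)) * P := by gcongr
      _ = _ := by ring
  exact (lt_of_mul_lt_mul_right key (by positivity)).trans_le hlow'
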